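/- Let a, m ∈ ℝ, b > 0, σ > 0 and ρ ∈ (−1, 1), and define ω(k) = a + b·(ρ(k − m) + √((k − m)² + σ²)). Set β = b(1 + ρ), assume 0 < β < 2, and assume ω(k) > 0 for all k ≥ k₀ for some k₀. Define g(k) = (1 − k·ω′(k)/(2ω(k)))² − (ω′(k))²/4 · (1/ω(k) + 1/4) + ω″(k)/2, d₋(k) = −k/√(ω(k)) − √(ω(k))/2, α = (1/2)·(1/√β + √β/2)², and the density f(k) = g(k)/√(2π·ω(k)) · exp(−d₋(k)²/2) for k ≥ k₀. Then there exists a constant C > 0 such that lim_{k → ∞} √k · e^(α·k) · f(k) = C. -/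

import Mathlib

open Real Filter

lemma sqrt_sq_add_sq_pos {s : ℝ} (hs : 0 < s) (x : ℝ) : 0 < √(x ^ 2 + s ^ 2) :=
  Real.sqrt_pos.2 (by positivity)

lemma hasDerivAt_sqrt_sub_sq_add_sq (m : ℝ) {s : ℝ} (hs : 0 < s) (x : ℝ) :
    HasDerivAt (fun k => √((k - m) ^ 2 + s ^ 2)) ((x - m) / √((x - m) ^ 2 + s ^ 2)) x := by
  have hpos : (x - m) ^ 2 + s ^ 2 ≠ 0 := by positivity
  refine (((((hasDerivAt_id' x).sub_const m).pow 2).add_const (s ^ 2)).sqrt hpos).congr_deriv ?_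
  simp [mul_div_mul_left]

lemma hasDerivAt_div_sqrt_sub_sq_add_sq (m : ℝ) {s : ℝ} (hs : 0 < s) (x : ℝ) :
    HasDerivAt (fun k => (k - m) / √((k - m) ^ 2 + s ^ 2))
      (s ^ 2 / √((x - m) ^ 2 + s ^ 2) ^ 3) x := by
  have hne := (sqrt_sq_add_sq_pos hs (x - m)).ne'
  have hsq : √((x - m) ^ 2 + s ^ 2) ^ 2 = (x - m) ^ 2 + s ^ 2 := Real.sq_sqrt (by positivity)
  refine (((hasDerivAt_id' x).sub_const m).div
    (hasDerivAt_sqrt_sub_sq_add_sq m hs x) hne).congr_deriv ?_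
  field_simp
  linarith

lemma tendsto_sqrt_sq_add_sq_atTop (s : ℝ) :
    Tendsto (fun x : ℝ => √(x ^ 2 + s ^ 2)) atTop atTop :=
  tendsto_atTop_mono (fun x : ℝ => show x ≤ _ from Real.le_sqrt_of_sq_le (by nlinarith [sq_nonneg s])) tendsto_id

lemma tendsto_sqrt_sq_add_sq_sub_self (s : ℝ) :
    Tendsto (fun x : ℝ => √(x ^ 2 + s ^ 2) - x) atTop (nhds 0) := by
  refine squeeze_zero' (Eventually.of_forall fun x => ?_) ?_
    (tendsto_const_nhds.div_atTop tendsto_id : Tendsto (fun x : ℝ => s ^ 2 / x) atTop (nhds 0))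
  · exact sub_nonneg.2 (Real.le_sqrt_of_sq_le (by nlinarith [sq_nonneg s]))
  · filter_upwards [eventually_gt_atTop 0] with x hx
    have h : 0 ≤ s ^ 2 / x := by positivity
    rw [sub_le_iff_le_add]
    refine Real.sqrt_le_iff.2 ⟨by positivity, ?_⟩
    have h' : s ^ 2 / x * x = s ^ 2 := div_mul_cancel₀ _ hx.ne'
    nlinarith [sq_nonneg (s ^ 2 / x)]

lemma tendsto_div_sqrt_sq_add_sq {s : ℝ} (hs : 0 < s) :
    Tendsto (fun x : ℝ => x / √(x ^ 2 + s ^ 2)) atTop (nhds 1) := by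
  have h := ((tendsto_sqrt_sq_add_sq_sub_self s).div_atTop
    (tendsto_sqrt_sq_add_sq_atTop s)).const_sub 1
  rw [sub_zero] at h
  refine h.congr fun x => ?_
  have := (sqrt_sq_add_sq_pos hs x).ne'
  field_simp
  ring

lemma tendsto_div_of_tendsto_sub_mul {w : ℝ → ℝ} {β c : ℝ}
    (hw : Tendsto (fun k => w k - β * k) atTop (nhds c)) :
    Tendsto (fun k => w k / k) atTop (nhds β) := by
  have h := (hw.div_atTop tendsto_id).add_const β
  rw [zero_add] at h
  refine h.congr' ?_
  filter_upwards [eventually_gt_atTop 0] with k hk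
  simp only [id]
  field_simp
  ring

/-- If the total variance `w` is asymptotic to the line `β k + c`, then the Gaussian exponent
`d₋² / 2` is asymptotic to a line of slope `(1 / √β + √β / 2)² / 2`. -/
lemma tendsto_mul_sub_sq_dminus {w : ℝ → ℝ} {β c : ℝ} (hβ : 0 < β)
    (hw : Tendsto (fun k => w k - β * k) atTop (nhds c)) (hpos : ∀ᶠ k in atTop, 0 < w k) :
    Tendsto (fun k => 1 / 2 * (1 / √β + √β / 2) ^ 2 * k + -(-k / √(w k) - √(w k) / 2) ^ 2 / 2)
      atTop (nhds (1 / 2 * (c / (β * β) - c / 4))) := by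
  have hdiv := tendsto_div_of_tendsto_sub_mul hw
  refine (((hw.div (hdiv.const_mul β) (by positivity)).sub (hw.div_const 4)).const_mul
    (1 / 2)).congr' ?_
  filter_upwards [eventually_gt_atTop 0, hpos] with k hk hwk
  have h1 : √β ^ 2 = β := Real.sq_sqrt hβ.le
  have h2 : √(w k) ^ 2 = w k := Real.sq_sqrt hwk.le
  have h3 : (1 / √β + √β / 2) ^ 2 = 1 / β + 1 + β / 4 := by
    rw [add_sq, div_pow, div_pow, h1]
    field_simp
    ring
  have h4 : (-k / √(w k) - √(w k) / 2) ^ 2 = k ^ 2 / w k + k + w k / 4 := by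
    rw [sub_sq, div_pow, div_pow, h2]
    field_simp
    ring
  simp only [Pi.div_apply]
  rw [h3, h4]
  field_simp
  ring

/-- The large-strike limit of the factor `g` in the risk-neutral density. -/
lemma tendsto_butterfly_factor {w w' w'' : ℝ → ℝ} {β c : ℝ} (hβ : 0 < β)
    (hw : Tendsto (fun k => w k - β * k) atTop (nhds c))
    (hw' : Tendsto w' atTop (nhds β)) (hw'' : Tendsto w'' atTop (nhds 0)) :
    Tendsto (fun k => (1 - k * w' k / (2 * w k)) ^ 2 - w' k ^ 2 / 4 * (1 / w k + 1 / 4) + w'' k / 2)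
      atTop (nhds ((4 - β ^ 2) / 16)) := by
  have hdiv := tendsto_div_of_tendsto_sub_mul hw
  have hinv : Tendsto (fun k => 1 / w k) atTop (nhds 0) := by
    refine tendsto_const_nhds.div_atTop ((hdiv.pos_mul_atTop hβ tendsto_id).congr' ?_)
    filter_upwards [eventually_gt_atTop 0] with k hk
    exact div_mul_cancel₀ _ hk.ne'
  have hratio : Tendsto (fun k => k * w' k / (2 * w k)) atTop (nhds (β / (2 * β))) := by
    refine (hw'.div (hdiv.const_mul 2) (by positivity)).congr' ?_
    filter_upwards [eventually_gt_atTop 0] with k hk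
    simp only [Pi.div_apply]
    field_simp
  convert ((((hratio.const_sub 1).pow 2).sub
    (((hw'.pow 2).div_const 4).mul (hinv.add_const (1 / 4)))).add (hw''.div_const 2)) using 2
  field_simp
  ring

lemma tendsto_sqrt_div_sqrt_two_pi_mul {w : ℝ → ℝ} {β c : ℝ} (hβ : 0 < β)
    (hw : Tendsto (fun k => w k - β * k) atTop (nhds c)) :
    Tendsto (fun k => √k / √(2 * π * w k)) atTop (nhds (√(2 * π * β))⁻¹) := by
  have hdiv := tendsto_div_of_tendsto_sub_mul hw
  refine ((hdiv.const_mul (2 * π)).sqrt.inv₀ (by positivity)).congr' ?_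
  filter_upwards [eventually_gt_atTop 0] with k hk
  rw [← mul_div_assoc, Real.sqrt_div' _ hk.le, inv_div]

/-- Tail-density asymptotic in the proof of Proposition 3.8: under the SVI
parameterization with large-strike slope `β = b(1+ρ) ∈ (0,2)`, the density
`f(k) = g(k)/√(2π ω(k)) · exp(-d₋(k)²/2)` satisfies
`√k · e^(αk) · f(k) → C` for some constant `C > 0`, where
`α = (1/2)(1/√β + √β/2)²`. -/
theorem svi_tail_density_asymptotic
    (a m b σ ρ : ℝ) (hb : 0 < b) (hσ : 0 < σ) (hρ1 : -1 < ρ) (hρ2 : ρ < 1)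
    (w : ℝ → ℝ)
    (hw : ∀ k, w k = a + b * (ρ * (k - m) + Real.sqrt ((k - m) ^ 2 + σ ^ 2)))
    (β : ℝ) (hβ : β = b * (1 + ρ)) (hβ0 : 0 < β) (hβ2 : β < 2)
    (k₀ : ℝ) (hwpos : ∀ k, k₀ ≤ k → 0 < w k)
    (g : ℝ → ℝ)
    (hg : ∀ k, g k =
      (1 - k * deriv w k / (2 * w k)) ^ 2 -
        (deriv w k) ^ 2 / 4 * (1 / w k + 1 / 4) + deriv (deriv w) k / 2)
    (d : ℝ → ℝ)
    (hd : ∀ k, d k = -k / Real.sqrt (w k) - Real.sqrt (w k) / 2)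
    (α : ℝ) (hα : α = 1 / 2 * (1 / Real.sqrt β + Real.sqrt β / 2) ^ 2)
    (f : ℝ → ℝ)
    (hf : ∀ k, k₀ ≤ k →
      f k = g k / Real.sqrt (2 * Real.pi * w k) * Real.exp (-(d k) ^ 2 / 2)) :
    ∃ C : ℝ, 0 < C ∧
      Tendsto (fun k : ℝ => Real.sqrt k * Real.exp (α * k) * f k) atTop (nhds C) := by
  have hu : Tendsto (fun k : ℝ => k - m) atTop atTop :=
    tendsto_atTop_add_const_right _ (-m) tendsto_id
  have hd1 : deriv w = fun k => b * (ρ + (k - m) / √((k - m) ^ 2 + σ ^ 2)) := by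
    ext k
    rw [funext hw]
    simpa using ((((((hasDerivAt_id' k).sub_const m).const_mul ρ).add
      (hasDerivAt_sqrt_sub_sq_add_sq m hσ k)).const_mul b).const_add a).deriv
  have hd2 : deriv (deriv w) = fun k => b * (σ ^ 2 / √((k - m) ^ 2 + σ ^ 2) ^ 3) := by
    ext k
    rw [hd1]
    exact (((hasDerivAt_div_sqrt_sub_sq_add_sq m hσ k).const_add ρ).const_mul b).deriv
  have hlin : Tendsto (fun k => w k - β * k) atTop (nhds (a - β * m)) := by
    have h := (((tendsto_sqrt_sq_add_sq_sub_self σ).comp hu).const_mul b).const_add (a - β * m)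
    rw [mul_zero, add_zero] at h
    refine h.congr fun k => ?_
    simp only [Function.comp_apply, hw, hβ]
    ring
  have hw1 : Tendsto (deriv w) atTop (nhds β) := by
    rw [hd1, hβ, add_comm 1 ρ]
    exact (((tendsto_div_sqrt_sq_add_sq hσ).comp hu).const_add ρ).const_mul b
  have hw2 : Tendsto (deriv (deriv w)) atTop (nhds 0) := by
    rw [hd2, ← mul_zero b]
    exact (tendsto_const_nhds.div_atTop ((tendsto_pow_atTop three_ne_zero).comp
      ((tendsto_sqrt_sq_add_sq_atTop σ).comp hu))).const_mul b
  have hexp := tendsto_mul_sub_sq_dminus hβ0 hlin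
    ((eventually_ge_atTop k₀).mono hwpos)
  refine ⟨_, ?_, (((tendsto_sqrt_div_sqrt_two_pi_mul hβ0 hlin).mul
    (tendsto_butterfly_factor hβ0 hlin hw1 hw2)).mul
    ((Real.continuous_exp.tendsto _).comp hexp)).congr' ?_⟩
  · have : 0 < 4 - β ^ 2 := by nlinarith
    positivity
  · filter_upwards [eventually_ge_atTop k₀] with k hk
    rw [hf k hk, hg, hd, hα, Function.comp_apply, Real.exp_add]
    ring
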